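/- Let f be a smooth, strictly convex function on a bounded convex domain Ω ⊂ ℝ² satisfying PDE (1.2) with parameter β ∈ ℝ. Let Ω* = ∇f(Ω) be the Legendre transform domain of f and let Ω'* ⊆ Ω* be a subdomain with dist(Ω'*, ∂Ω*) > 0. Then det(f_ij)(x) ≥ b₀ for every x ∈ Ω with ∇f(x) ∈ Ω'*, where b₀ is a constant depending only on dist(Ω'*, ∂Ω*), diam(Ω), diam(Ω*) and β. -/

import Mathlib

open Real Filter Topology Matrix

noncomputable section

/-- The `i`-th partial derivative of `f`. -/
def pd {n : ℕ} (i : Fin n) (f : (Fin n → ℝ) → ℝ) : (Fin n → ℝ) → ℝ :=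
  fun x => fderiv ℝ f x (Pi.single i 1)

/-- The Hessian matrix `(∂²f/∂x_i∂x_j)` of `f` at `x`. -/
def hess {n : ℕ} (f : (Fin n → ℝ) → ℝ) (x : Fin n → ℝ) : Matrix (Fin n) (Fin n) ℝ :=
  Matrix.of fun i j => pd i (pd j f) x

/-- The gradient vector of `f` at `x`. -/
def gradv {n : ℕ} (f : (Fin n → ℝ) → ℝ) (x : Fin n → ℝ) : Fin n → ℝ :=
  fun i => pd i f x

/-- `ρ := (det (f_ij))^(-1/(n+2))`. -/
def rho {n : ℕ} (f : (Fin n → ℝ) → ℝ) (x : Fin n → ℝ) : ℝ :=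
  (hess f x).det ^ (-(1 : ℝ) / ((n : ℝ) + 2))

/-- The squared norm `‖grad h‖² = ∑ f^{ij} h_i h_j` with respect to the Calabi metric of `f`. -/
def gradSq {n : ℕ} (f h : (Fin n → ℝ) → ℝ) (x : Fin n → ℝ) : ℝ :=
  ∑ i, ∑ j, (hess f x)⁻¹ i j * pd i h x * pd j h x

/-- The Laplacian `Δh = (1/√det)(∑ ∂_i(√det · f^{ij} ∂_j h))` with respect to the
Calabi metric of `f`. -/
def calabiLap {n : ℕ} (f h : (Fin n → ℝ) → ℝ) (x : Fin n → ℝ) : ℝ :=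
  (Real.sqrt (hess f x).det)⁻¹ *
    ∑ i, ∑ j, pd i (fun y => Real.sqrt (hess f y).det * (hess f y)⁻¹ i j * pd j h y) x

/-- `Φ := ‖grad ρ‖²/ρ²`. -/
def Phi {n : ℕ} (f : (Fin n → ℝ) → ℝ) (x : Fin n → ℝ) : ℝ :=
  gradSq f (rho f) x / (rho f x) ^ 2

/-- PDE (1.2): `Δρ = -β ‖grad ρ‖²/ρ` on `Ω`. -/
def PDE2 {n : ℕ} (f : (Fin n → ℝ) → ℝ) (β : ℝ) (Ω : Set (Fin n → ℝ)) : Prop :=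
  ∀ x ∈ Ω, calabiLap f (rho f) x = -β * gradSq f (rho f) x / rho f x

/-- The cofactor matrix of a square matrix. -/
def cof {n : ℕ} (H : Matrix (Fin n) (Fin n) ℝ) : Matrix (Fin n) (Fin n) ℝ :=
  (Matrix.adjugate H)ᵀ

/-- PDE (1.1): `∑ F^{ij} w_ij = 0` with `w = (det (f_ij))^a` on `Ω`, where `(F^{ij})`
is the cofactor matrix of the Hessian of `f`. -/
def PDE1 {n : ℕ} (f : (Fin n → ℝ) → ℝ) (a : ℝ) (Ω : Set (Fin n → ℝ)) : Prop :=
  ∀ x ∈ Ω, ∑ i, ∑ j,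
    cof (hess f x) i j * pd i (pd j fun y => (hess f y).det ^ a) x = 0

/-- `f` is a quadratic polynomial on `ℝ²`. -/
def IsQuadratic (f : (Fin 2 → ℝ) → ℝ) : Prop :=
  ∃ (Q : Matrix (Fin 2) (Fin 2) ℝ) (b : Fin 2 → ℝ) (c : ℝ),
    ∀ x, f x = (∑ i, ∑ j, Q i j * x i * x j) + (∑ i, b i * x i) + c

/-- Euclidean open ball of radius `r` centered at `0` in `ℝ²`. -/
def ebal (r : ℝ) : Set (Fin 2 → ℝ) := {x | (x 0) ^ 2 + (x 1) ^ 2 < r ^ 2}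

/-- Euclidean norm on `ℝ²`. -/
def enorm2 (x : Fin 2 → ℝ) : ℝ := Real.sqrt ((x 0) ^ 2 + (x 1) ^ 2)

/-- A normalized convex domain: `B_{2^{-3/2}}(0) ⊆ Ω ⊆ B_1(0)`. -/
def NormalizedDomain (Ω : Set (Fin 2 → ℝ)) : Prop :=
  IsOpen Ω ∧ Convex ℝ Ω ∧ ebal ((2 : ℝ) ^ (-(3 : ℝ) / 2)) ⊆ Ω ∧ Ω ⊆ ebal 1

/-- The class `𝒮(Ω,C)`: smooth strictly convex functions on `Ω` with `inf f = 0` and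
`f = C` on `∂Ω`. -/
def SClass (Ω : Set (Fin 2 → ℝ)) (C : ℝ) (f : (Fin 2 → ℝ) → ℝ) : Prop :=
  ContDiffOn ℝ (⊤ : ℕ∞) f Ω ∧ (∀ x ∈ Ω, (hess f x).PosDef) ∧
    sInf (f '' Ω) = 0 ∧ ContinuousOn f (closure Ω) ∧ ∀ x ∈ frontier Ω, f x = C

/-- `u` is the Legendre transform function of `f` relative to `0`:
`u(∇f(x)) = ⟨x, ∇f(x)⟩ - f(x)`. -/
def LegendreOf (Ω : Set (Fin 2 → ℝ)) (f u : (Fin 2 → ℝ) → ℝ) : Prop :=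
  ∀ x ∈ Ω, u (gradv f x) = (∑ i, x i * gradv f x i) - f x

end

section helpers

lemma cd_pd {Ω : Set (Fin 2 → ℝ)} (hΩ : IsOpen Ω) {g : (Fin 2 → ℝ) → ℝ}
    (hg : ContDiffOn ℝ (⊤ : ℕ∞) g Ω) (i : Fin 2) : ContDiffOn ℝ (⊤ : ℕ∞) (pd i g) Ω := by
  have h := hg.fderiv_of_isOpen (m := ((⊤ : ℕ∞) : WithTop ℕ∞)) hΩ (by simp)
  exact h.clm_apply contDiffOn_const

lemma cd_diff {Ω : Set (Fin 2 → ℝ)} (hΩ : IsOpen Ω) {g : (Fin 2 → ℝ) → ℝ}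
    (hg : ContDiffOn ℝ (⊤ : ℕ∞) g Ω) {x : Fin 2 → ℝ} (hx : x ∈ Ω) : DifferentiableAt ℝ g x :=
  (hg.contDiffAt (hΩ.mem_nhds hx)).differentiableAt (by simp)

lemma pd_congr {Ω : Set (Fin 2 → ℝ)} (hΩ : IsOpen Ω) {g h : (Fin 2 → ℝ) → ℝ}
    (H : ∀ y ∈ Ω, g y = h y) (i : Fin 2) {x : Fin 2 → ℝ} (hx : x ∈ Ω) : pd i g x = pd i h x := by
  have : g =ᶠ[𝓝 x] h := by
    filter_upwards [hΩ.mem_nhds hx] with y hy using H y hy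
  unfold pd
  rw [this.fderiv_eq]

lemma pd_add {g h : (Fin 2 → ℝ) → ℝ} {x : Fin 2 → ℝ} (hg : DifferentiableAt ℝ g x)
    (hh : DifferentiableAt ℝ h x) (i : Fin 2) :
    pd i (fun y => g y + h y) x = pd i g x + pd i h x := by
  unfold pd; rw [fderiv_fun_add hg hh]; simp

lemma pd_sub {g h : (Fin 2 → ℝ) → ℝ} {x : Fin 2 → ℝ} (hg : DifferentiableAt ℝ g x)
    (hh : DifferentiableAt ℝ h x) (i : Fin 2) :
    pd i (fun y => g y - h y) x = pd i g x - pd i h x := by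
  unfold pd; rw [fderiv_fun_sub hg hh]; simp

lemma pd_mul {g h : (Fin 2 → ℝ) → ℝ} {x : Fin 2 → ℝ} (hg : DifferentiableAt ℝ g x)
    (hh : DifferentiableAt ℝ h x) (i : Fin 2) :
    pd i (fun y => g y * h y) x = g x * pd i h x + pd i g x * h x := by
  unfold pd; rw [fderiv_fun_mul hg hh]; simp; ring

lemma pd_comp {g : (Fin 2 → ℝ) → ℝ} {x : Fin 2 → ℝ} (hg : DifferentiableAt ℝ g x)
    {k : ℝ → ℝ} {k' : ℝ} (hk : HasDerivAt k k' (g x)) (i : Fin 2) :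
    pd i (fun y => k (g y)) x = k' * pd i g x := by
  unfold pd
  have := (hk.comp_hasFDerivAt x hg.hasFDerivAt).fderiv
  simp only [Function.comp_def] at this
  rw [this]; simp

lemma pd_const_mul {g : (Fin 2 → ℝ) → ℝ} {x : Fin 2 → ℝ} (hg : DifferentiableAt ℝ g x)
    (k : ℝ) (i : Fin 2) : pd i (fun y => k * g y) x = k * pd i g x := by
  unfold pd; rw [fderiv_const_mul hg]; simp

lemma pd_const (k : ℝ) (x : Fin 2 → ℝ) (i : Fin 2) : pd i (fun _ => k) x = 0 := by
  unfold pd; simp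

lemma pd_coord (j : Fin 2) (x : Fin 2 → ℝ) (i : Fin 2) :
    pd i (fun y => y j) x = if i = j then 1 else 0 := by
  unfold pd
  rw [(hasFDerivAt_apply j x).fderiv]
  simp [Pi.single_apply, eq_comm]

lemma pd_comm {Ω : Set (Fin 2 → ℝ)} (hΩ : IsOpen Ω) {g : (Fin 2 → ℝ) → ℝ}
    (hg : ContDiffOn ℝ (⊤ : ℕ∞) g Ω) {x : Fin 2 → ℝ} (hx : x ∈ Ω) (i j : Fin 2) :
    pd i (pd j g) x = pd j (pd i g) x := by
  have hc := hg.contDiffAt (hΩ.mem_nhds hx)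
  have hs : IsSymmSndFDerivAt ℝ g x := hc.isSymmSndFDerivAt (by simp only [minSmoothness_of_isRCLikeNormedField]; exact WithTop.coe_le_coe.2 le_top)
  have hd : DifferentiableAt ℝ (fderiv ℝ g) x :=
    (hc.fderiv_right (m := 1) (by norm_cast)).differentiableAt (by simp)
  have key : ∀ i j : Fin 2, pd i (pd j g) x
      = fderiv ℝ (fderiv ℝ g) x (Pi.single i 1) (Pi.single j 1) := by
    intro i j
    unfold pd
    rw [fderiv_clm_apply hd (by fun_prop)]
    simp
  rw [key, key, hs.eq]

lemma fderiv_eq_pd (g : (Fin 2 → ℝ) → ℝ) (x v : Fin 2 → ℝ) :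
    fderiv ℝ g x v = v 0 * pd 0 g x + v 1 * pd 1 g x := by
  have : v = v 0 • (Pi.single 0 1 : Fin 2 → ℝ) + v 1 • (Pi.single 1 1 : Fin 2 → ℝ) := by
    ext i; fin_cases i <;> simp
  conv_lhs => rw [this]
  rw [map_add, map_smul, map_smul]; rfl

lemma deriv_line {g : (Fin 2 → ℝ) → ℝ} {x v : Fin 2 → ℝ} {t : ℝ}
    (hg : DifferentiableAt ℝ g (x + t • v)) :
    HasDerivAt (fun s : ℝ => g (x + s • v))
      (v 0 * pd 0 g (x + t • v) + v 1 * pd 1 g (x + t • v)) t := by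
  rw [← fderiv_eq_pd]
  have h1 : HasDerivAt (fun s : ℝ => x + s • v) v t := by
    simpa using ((hasDerivAt_id t).smul_const v).const_add x
  exact hg.hasFDerivAt.comp_hasDerivAt t h1

lemma second_test_one {h : ℝ → ℝ} (hm : IsLocalMax h 0) (hc : ContinuousAt h 0) :
    deriv (deriv h) 0 ≤ 0 := by
  by_contra hpos
  push Not at hpos
  have hmin := isLocalMin_of_deriv_deriv_pos hpos hm.deriv_eq_zero hc
  have heq : h =ᶠ[𝓝 0] fun _ => h 0 := by
    filter_upwards [hm, hmin] with t h1 h2 using le_antisymm h1 h2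
  have h3 : deriv h =ᶠ[𝓝 0] fun _ => 0 := by
    have := heq.deriv
    simpa using this
  have h4 := h3.deriv_eq
  simp at h4
  linarith

lemma second_test {U : Set (Fin 2 → ℝ)} (hU : IsOpen U) {z : (Fin 2 → ℝ) → ℝ}
    (hz : ContDiffOn ℝ (⊤ : ℕ∞) z U) {x : Fin 2 → ℝ} (hx : x ∈ U) (hm : IsLocalMax z x)
    (v : Fin 2 → ℝ) :
    v 0 * (v 0 * pd 0 (pd 0 z) x + v 1 * pd 0 (pd 1 z) x)
      + v 1 * (v 0 * pd 1 (pd 0 z) x + v 1 * pd 1 (pd 1 z) x) ≤ 0 := by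
  have hcont : Continuous (fun t : ℝ => x + t • v) := by fun_prop
  have hnear : ∀ᶠ t : ℝ in 𝓝 0, x + t • v ∈ U := by
    apply hcont.continuousAt.eventually_mem
    simpa using hU.mem_nhds hx
  have hmax : IsLocalMax (fun t : ℝ => z (x + t • v)) 0 := by
    have : Tendsto (fun t : ℝ => x + t • v) (𝓝 0) (𝓝 x) := by
      have := hcont.tendsto 0
      simpa using this
    have := this.eventually hm
    simpa [IsLocalMax, IsMaxFilter] using this
  have hx0 : x + (0 : ℝ) • v ∈ U := by simpa using hx
  have hd : deriv (fun t : ℝ => z (x + t • v)) =ᶠ[𝓝 0]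
      fun t => v 0 * pd 0 z (x + t • v) + v 1 * pd 1 z (x + t • v) := by
    filter_upwards [hnear] with t ht using (deriv_line (cd_diff hU hz ht)).deriv
  have h2 := second_test_one hmax (deriv_line (cd_diff hU hz hx0)).continuousAt
  rw [hd.deriv_eq] at h2
  have h3 := ((deriv_line (cd_diff hU (cd_pd hU hz 0) hx0)).const_mul (v 0)).add
    ((deriv_line (cd_diff hU (cd_pd hU hz 1) hx0)).const_mul (v 1))
  replace h2 := le_of_eq_of_le h3.deriv.symm h2
  simp only [zero_smul, add_zero] at h2
  nlinarith

lemma first_test {z : (Fin 2 → ℝ) → ℝ} {x : Fin 2 → ℝ} (hm : IsLocalMax z x) (i : Fin 2) :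
    pd i z x = 0 := by
  unfold pd; rw [hm.fderiv_eq_zero]; simp

end helpers
section pde

/-- `φ = -log det`. -/
noncomputable def phi (f : (Fin 2 → ℝ) → ℝ) : (Fin 2 → ℝ) → ℝ := fun y => -Real.log (hess f y).det

variable {Ω : Set (Fin 2 → ℝ)} {f : (Fin 2 → ℝ) → ℝ}

lemma det_eq (hΩ : IsOpen Ω) (hf : ContDiffOn ℝ (⊤ : ℕ∞) f Ω) {y : Fin 2 → ℝ} (hy : y ∈ Ω) :
    (hess f y).det = pd 0 (pd 0 f) y * pd 1 (pd 1 f) y - pd 0 (pd 1 f) y * pd 0 (pd 1 f) y := by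
  rw [Matrix.det_fin_two]
  simp only [hess, Matrix.of_apply]
  rw [pd_comm hΩ hf hy 1 0]

lemma cd_det (hΩ : IsOpen Ω) (hf : ContDiffOn ℝ (⊤ : ℕ∞) f Ω) :
    ContDiffOn ℝ (⊤ : ℕ∞) (fun y => (hess f y).det) Ω := by
  have h : ∀ i j, ContDiffOn ℝ (⊤ : ℕ∞) (pd i (pd j f)) Ω :=
    fun i j => cd_pd hΩ (cd_pd hΩ hf j) i
  exact (((h 0 0).mul (h 1 1)).sub ((h 0 1).mul (h 0 1))).congr fun y hy => det_eq hΩ hf hy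

lemma cd_phi (hΩ : IsOpen Ω) (hf : ContDiffOn ℝ (⊤ : ℕ∞) f Ω)
    (hpos : ∀ x ∈ Ω, (hess f x).PosDef) : ContDiffOn ℝ (⊤ : ℕ∞) (phi f) Ω :=
  ((cd_det hΩ hf).log fun x hx => (hpos x hx).det_pos.ne').neg

lemma exp_phi {y : Fin 2 → ℝ} (hy : 0 < (hess f y).det) :
    Real.exp (phi f y) = (hess f y).det⁻¹ := by
  rw [phi, Real.exp_neg, Real.exp_log hy]

lemma det_phi {y : Fin 2 → ℝ} (hy : 0 < (hess f y).det) :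
    (hess f y).det = (Real.exp (phi f y / 4))⁻¹ ^ 4 := by
  rw [inv_pow, ← Real.exp_nat_mul]
  push_cast
  rw [show 4 * (phi f y / 4) = phi f y by ring, exp_phi hy, inv_inv]

lemma rho_phi {y : Fin 2 → ℝ} (hy : 0 < (hess f y).det) :
    rho f y = Real.exp (phi f y / 4) := by
  rw [rho, Real.rpow_def_of_pos hy, phi]
  congr 1; push_cast; ring

lemma sqrt_phi {y : Fin 2 → ℝ} (hy : 0 < (hess f y).det) :
    Real.sqrt (hess f y).det = (Real.exp (phi f y / 4))⁻¹ ^ 2 := by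
  rw [det_phi hy]
  rw [show (Real.exp (phi f y / 4))⁻¹ ^ 4 = ((Real.exp (phi f y / 4))⁻¹ ^ 2) ^ 2 by ring]
  exact Real.sqrt_sq (by positivity)

/-- the derivatives of `φ` through the third derivatives of `f` -/
lemma pd_phi (hΩ : IsOpen Ω) (hf : ContDiffOn ℝ (⊤ : ℕ∞) f Ω)
    (hpos : ∀ x ∈ Ω, (hess f x).PosDef) {x : Fin 2 → ℝ} (hx : x ∈ Ω) (i : Fin 2) :
    (hess f x).det * pd i (phi f) x =
      -(pd 0 (pd 0 f) x * pd i (pd 1 (pd 1 f)) x + pd i (pd 0 (pd 0 f)) x * pd 1 (pd 1 f) x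
        - 2 * pd 0 (pd 1 f) x * pd i (pd 0 (pd 1 f)) x) := by
  have h : ∀ i j, DifferentiableAt ℝ (pd i (pd j f)) x :=
    fun i j => cd_diff hΩ (cd_pd hΩ (cd_pd hΩ hf j) i) hx
  have hD := cd_diff hΩ (cd_det hΩ hf) hx
  have hp := (hpos x hx).det_pos
  have h1 : pd i (phi f) x = -((hess f x).det)⁻¹ * pd i (fun y => (hess f y).det) x :=
    pd_comp (k := fun t => -Real.log t) hD (Real.hasDerivAt_log hp.ne').neg i
  rw [h1, pd_congr hΩ (fun y hy => det_eq hΩ hf hy) i hx]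
  rw [pd_sub ((h 0 0).fun_mul (h 1 1)) ((h 0 1).fun_mul (h 0 1)), pd_mul (h 0 0) (h 1 1),
    pd_mul (h 0 1) (h 0 1)]
  field_simp
  ring

lemma inv_hess (hΩ : IsOpen Ω) (hf : ContDiffOn ℝ (⊤ : ℕ∞) f Ω) {y : Fin 2 → ℝ} (hy : y ∈ Ω) :
    (hess f y)⁻¹ = (hess f y).det⁻¹ •
      !![pd 1 (pd 1 f) y, -pd 0 (pd 1 f) y; -pd 0 (pd 1 f) y, pd 0 (pd 0 f) y] := by
  rw [Matrix.inv_def, Matrix.adjugate_fin_two, Ring.inverse_eq_inv']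
  simp only [hess, Matrix.of_apply]
  rw [pd_comm hΩ hf hy 1 0]

lemma pd_rho (hΩ : IsOpen Ω) (hf : ContDiffOn ℝ (⊤ : ℕ∞) f Ω)
    (hpos : ∀ x ∈ Ω, (hess f x).PosDef) {x : Fin 2 → ℝ} (hx : x ∈ Ω) (i : Fin 2) :
    pd i (rho f) x = Real.exp (phi f x / 4) / 4 * pd i (phi f) x := by
  rw [pd_congr hΩ (fun y hy => rho_phi (hpos y hy).det_pos) i hx]
  refine pd_comp (k := fun t => Real.exp (t / 4)) (cd_diff hΩ (cd_phi hΩ hf hpos) hx) ?_ i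
  have := ((hasDerivAt_id (phi f x)).div_const 4).exp
  simpa [div_eq_mul_inv] using this

/-- one term of the divergence -/
lemma pd_term (hΩ : IsOpen Ω) (hf : ContDiffOn ℝ (⊤ : ℕ∞) f Ω)
    (hpos : ∀ x ∈ Ω, (hess f x).PosDef) {x : Fin 2 → ℝ} (hx : x ∈ Ω) (i j : Fin 2)
    {G : (Fin 2 → ℝ) → ℝ} (hG : ContDiffOn ℝ (⊤ : ℕ∞) G Ω)
    (hGe : ∀ y ∈ Ω, (hess f y)⁻¹ i j = (hess f y).det⁻¹ * G y) :
    pd i (fun y => Real.sqrt (hess f y).det * (hess f y)⁻¹ i j * pd j (rho f) y) x =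
      Real.exp (phi f x / 4) ^ 3 / 4 * (G x * pd i (pd j (phi f)) x + pd i G x * pd j (phi f) x
        + 3 / 4 * pd i (phi f) x * (G x * pd j (phi f) x)) := by
  have hφ := cd_phi hΩ hf hpos
  have e : ∀ y ∈ Ω, Real.sqrt (hess f y).det * (hess f y)⁻¹ i j * pd j (rho f) y =
      (Real.exp (phi f y / 4) ^ 3 / 4) * (G y * pd j (phi f) y) := by
    intro y hy
    have hp := (hpos y hy).det_pos
    rw [hGe y hy, pd_rho hΩ hf hpos hy, sqrt_phi hp, det_phi hp]
    have := (Real.exp_pos (phi f y / 4)).ne'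
    field_simp
  rw [pd_congr hΩ e i hx]
  have hE : HasDerivAt (fun t : ℝ => Real.exp (t / 4) ^ 3 / 4)
      (Real.exp (phi f x / 4) ^ 3 / 4 * (3 / 4)) (phi f x) := by
    have := ((((hasDerivAt_id (phi f x)).div_const 4).exp).pow 3).div_const 4
    refine HasDerivAt.congr_deriv this ?_
    simp; ring
  have hd := cd_diff hΩ hφ hx
  have hEd : DifferentiableAt ℝ (fun y => Real.exp (phi f y / 4) ^ 3 / 4) x :=
    hE.differentiableAt.comp x hd
  have hGd := cd_diff hΩ hG hx
  have hjd := cd_diff hΩ (cd_pd hΩ hφ j) hx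
  rw [pd_mul hEd (hGd.fun_mul hjd), pd_mul hGd hjd,
    pd_comp (k := fun t : ℝ => Real.exp (t / 4) ^ 3 / 4) hd hE]
  ring

lemma pde_expand (hΩ : IsOpen Ω) (hf : ContDiffOn ℝ (⊤ : ℕ∞) f Ω)
    (hpos : ∀ x ∈ Ω, (hess f x).PosDef) {β : ℝ} (hP : PDE2 f β Ω) {x : Fin 2 → ℝ} (hx : x ∈ Ω) :
    pd 1 (pd 1 f) x * pd 0 (pd 0 (phi f)) x - 2 * pd 0 (pd 1 f) x * pd 0 (pd 1 (phi f)) x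
      + pd 0 (pd 0 f) x * pd 1 (pd 1 (phi f)) x =
    (-(3 + β) / 4) * (pd 1 (pd 1 f) x * pd 0 (phi f) x ^ 2
      - 2 * pd 0 (pd 1 f) x * pd 0 (phi f) x * pd 1 (phi f) x
      + pd 0 (pd 0 f) x * pd 1 (phi f) x ^ 2) := by
  have hc : ∀ i j, ContDiffOn ℝ (⊤ : ℕ∞) (pd i (pd j f)) Ω :=
    fun i j => cd_pd hΩ (cd_pd hΩ hf j) i
  have hφ := cd_phi hΩ hf hpos
  have hp := (hpos x hx).det_pos
  have h := hP x hx
  unfold calabiLap gradSq at h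
  simp only [Fin.sum_univ_two] at h
  rw [pd_term hΩ hf hpos hx 0 0 (hc 1 1) (fun y hy => by rw [inv_hess hΩ hf hy]; simp),
    pd_term hΩ hf hpos hx 0 1 (hc 0 1).neg (fun y hy => by rw [inv_hess hΩ hf hy]; simp),
    pd_term hΩ hf hpos hx 1 0 (hc 0 1).neg (fun y hy => by rw [inv_hess hΩ hf hy]; simp),
    pd_term hΩ hf hpos hx 1 1 (hc 0 0) (fun y hy => by rw [inv_hess hΩ hf hy]; simp),
    inv_hess hΩ hf hx, pd_rho hΩ hf hpos hx, pd_rho hΩ hf hpos hx, sqrt_phi hp, rho_phi hp,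
    det_phi hp] at h
  have hneg : ∀ i, pd i (fun y => -pd 0 (pd 1 f) y) x = - pd i (pd 0 (pd 1 f)) x := by
    intro i
    have := pd_const_mul (cd_diff hΩ (hc 0 1) hx) (-1) i
    simpa using this
  have h3a : pd 0 (pd 1 (pd 1 f)) x = pd 1 (pd 0 (pd 1 f)) x :=
    pd_comm hΩ (cd_pd hΩ hf 1) hx 0 1
  have h3b : pd 0 (pd 0 (pd 1 f)) x = pd 1 (pd 0 (pd 0 f)) x := by
    rw [pd_congr hΩ (fun y hy => pd_comm hΩ hf hy 0 1) 0 hx]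
    exact pd_comm hΩ (cd_pd hΩ hf 0) hx 0 1
  rw [hneg, hneg, h3a, h3b, pd_comm hΩ hφ hx 1 0] at h
  have hw := Real.exp_pos (phi f x / 4)
  set w := Real.exp (phi f x / 4)
  simp at h
  field_simp at h
  linarith

end pde
section topo

variable {Ω : Set (Fin 2 → ℝ)} {f : (Fin 2 → ℝ) → ℝ}

lemma quad_pos (hΩ : IsOpen Ω) (hf : ContDiffOn ℝ (⊤ : ℕ∞) f Ω)
    (hpos : ∀ x ∈ Ω, (hess f x).PosDef) {x : Fin 2 → ℝ} (hx : x ∈ Ω) {v : Fin 2 → ℝ}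
    (hv : v ≠ 0) :
    0 < v 0 * (v 0 * pd 0 (pd 0 f) x + v 1 * pd 1 (pd 0 f) x)
      + v 1 * (v 0 * pd 0 (pd 1 f) x + v 1 * pd 1 (pd 1 f) x) := by
  have h := (hpos x hx).dotProduct_mulVec_pos hv
  simp [dotProduct, Matrix.mulVec, Fin.sum_univ_two, hess] at h
  nlinarith [pd_comm hΩ hf hx 0 1]

lemma cd_gradv (hΩ : IsOpen Ω) (hf : ContDiffOn ℝ (⊤ : ℕ∞) f Ω) :
    ContDiffOn ℝ (⊤ : ℕ∞) (gradv f) Ω :=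
  contDiffOn_pi.2 fun i => cd_pd hΩ hf i

lemma gradv_inj (hΩ : IsOpen Ω) (hcv : Convex ℝ Ω) (hf : ContDiffOn ℝ (⊤ : ℕ∞) f Ω)
    (hpos : ∀ x ∈ Ω, (hess f x).PosDef) : Set.InjOn (gradv f) Ω := by
  intro p hp q hq hpq
  by_contra hne
  have hv : q - p ≠ 0 := sub_ne_zero.2 (Ne.symm hne)
  set v := q - p with hvdef
  have hmem : ∀ t ∈ Set.Icc (0 : ℝ) 1, p + t • v ∈ Ω := fun t ht =>
    hcv.add_smul_sub_mem hp hq ht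
  let g : ℝ → ℝ := fun t => v 0 * pd 0 f (p + t • v) + v 1 * pd 1 f (p + t • v)
  have hg : ∀ t ∈ Set.Icc (0 : ℝ) 1, HasDerivAt g
      (v 0 * (v 0 * pd 0 (pd 0 f) (p + t • v) + v 1 * pd 1 (pd 0 f) (p + t • v))
      + v 1 * (v 0 * pd 0 (pd 1 f) (p + t • v) + v 1 * pd 1 (pd 1 f) (p + t • v))) t := by
    intro t ht
    exact ((deriv_line (cd_diff hΩ (cd_pd hΩ hf 0) (hmem t ht))).const_mul (v 0)).add
      ((deriv_line (cd_diff hΩ (cd_pd hΩ hf 1) (hmem t ht))).const_mul (v 1))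
  have hmono : StrictMonoOn g (Set.Icc 0 1) := by
    apply strictMonoOn_of_deriv_pos (convex_Icc 0 1)
    · intro t ht
      exact (hg t ht).continuousAt.continuousWithinAt
    · intro t ht
      rw [interior_Icc] at ht
      have ht' := Set.Ioo_subset_Icc_self ht
      rw [(hg t ht').deriv]
      exact quad_pos hΩ hf hpos (hmem t ht') hv
  have hlt := hmono (by simp : (0 : ℝ) ∈ Set.Icc (0 : ℝ) 1)
    (by simp : (1 : ℝ) ∈ Set.Icc (0 : ℝ) 1) one_pos
  have e0 := congrFun hpq 0
  have e1 := congrFun hpq 1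
  simp only [gradv] at e0 e1
  have hq' : p + v = q := by rw [hvdef]; abel
  simp only [g, zero_smul, add_zero, one_smul, hq', e0, e1] at hlt
  exact lt_irrefl _ hlt

lemma gradv_nhds (hΩ : IsOpen Ω) (hf : ContDiffOn ℝ (⊤ : ℕ∞) f Ω)
    (hpos : ∀ x ∈ Ω, (hess f x).PosDef) {x : Fin 2 → ℝ} (hx : x ∈ Ω) :
    map (gradv f) (𝓝 x) = 𝓝 (gradv f x) := by
  have hc := (cd_gradv hΩ hf).contDiffAt (hΩ.mem_nhds hx)
  have hs := hc.hasStrictFDerivAt (by simp)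
  apply hs.map_nhds_eq_of_surj
  rw [← LinearMap.ker_eq_bot_iff_range_eq_top, LinearMap.ker_eq_bot']
  intro v hv
  by_contra hne
  have hq := quad_pos hΩ hf hpos hx hne
  have key : ∀ k, fderiv ℝ (gradv f) x v k = v 0 * pd 0 (pd k f) x + v 1 * pd 1 (pd k f) x := by
    intro k
    rw [← fderiv_eq_pd]
    have := hasFDerivAt_pi'.1 hs.hasFDerivAt k
    have h2 := this.fderiv
    change fderiv ℝ (pd k f) x = _ at h2
    rw [h2]; rfl
  have hv' : fderiv ℝ (gradv f) x v = 0 := hv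
  rw [← key, ← key, hv'] at hq
  simp at hq

lemma enorm2_sq (x : Fin 2 → ℝ) : enorm2 x ^ 2 = x 0 ^ 2 + x 1 ^ 2 :=
  Real.sq_sqrt (by positivity)

lemma enorm2_le {x : Fin 2 → ℝ} {r : ℝ} (hr : 0 ≤ r) :
    enorm2 x ≤ r ↔ x 0 ^ 2 + x 1 ^ 2 ≤ r ^ 2 := Real.sqrt_le_left hr

lemma gball_sub {S : Set (Fin 2 → ℝ)} {w : Fin 2 → ℝ} (hw : w ∈ S) {δ r : ℝ} (hr0 : 0 ≤ r)
    (hr : r < δ) (hd : ∀ q ∈ frontier S, δ ≤ enorm2 (w - q)) :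
    {q : Fin 2 → ℝ | (q 0 - w 0) ^ 2 + (q 1 - w 1) ^ 2 ≤ r ^ 2} ⊆ S := by
  intro q hq
  by_contra hqS
  have hseg : IsPreconnected (segment ℝ w q) := (convex_segment w q).isPreconnected
  have hne : (segment ℝ w q ∩ frontier S).Nonempty := by
    by_contra hcon
    rw [Set.not_nonempty_iff_eq_empty] at hcon
    have h1 := hseg.subset_or_subset (u := interior S) (v := (closure S)ᶜ) isOpen_interior
      isClosed_closure.isOpen_compl
      (Set.disjoint_left.2 fun a ha hb => hb (subset_closure (interior_subset ha))) (by
        intro a ha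
        by_contra hcc
        have : a ∈ segment ℝ w q ∩ frontier S := by
          refine ⟨ha, ?_, ?_⟩
          · by_contra h; exact hcc (Or.inr h)
          · intro h; exact hcc (Or.inl h)
        rw [hcon] at this
        exact this)
    rcases h1 with h1 | h1
    · exact hqS (interior_subset (h1 (right_mem_segment ℝ w q)))
    · exact h1 (left_mem_segment ℝ w q) (subset_closure hw)
  obtain ⟨a, ha, haf⟩ := hne
  have h2 := hd a haf
  rw [segment_eq_image'] at ha
  obtain ⟨t, ht, rfl⟩ := ha
  have h3 : enorm2 (w - (w + t • (q - w))) ≤ r := by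
    rw [enorm2_le hr0]
    simp only [Pi.sub_apply, Pi.add_apply, Pi.smul_apply, smul_eq_mul]
    have hq' : (q 0 - w 0) ^ 2 + (q 1 - w 1) ^ 2 ≤ r ^ 2 := hq
    have ht2 : t ^ 2 ≤ 1 := by nlinarith [ht.1, ht.2]
    nlinarith [sq_nonneg (q 0 - w 0), sq_nonneg (q 1 - w 1)]
  linarith

lemma compact_pre (hΩ : IsOpen Ω) (hcv : Convex ℝ Ω) (hf : ContDiffOn ℝ (⊤ : ℕ∞) f Ω)
    (hpos : ∀ x ∈ Ω, (hess f x).PosDef) {w : Fin 2 → ℝ} {r : ℝ}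
    (hsub : {q : Fin 2 → ℝ | (q 0 - w 0) ^ 2 + (q 1 - w 1) ^ 2 ≤ r ^ 2} ⊆ gradv f '' Ω) :
    IsCompact {x | x ∈ Ω ∧ (pd 0 f x - w 0) ^ 2 + (pd 1 f x - w 1) ^ 2 ≤ r ^ 2} := by
  let e : Ω → (Fin 2 → ℝ) := fun x => gradv f x
  have hec : Continuous e := continuousOn_iff_continuous_domRestrict.1 (cd_gradv hΩ hf).continuousOn
  have hei : Function.Injective e := (gradv_inj hΩ hcv hf hpos).injective
  have heo : IsOpenMap e := by
    rw [isOpenMap_iff_nhds_le]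
    intro x
    change 𝓝 (gradv f x) ≤ map (gradv f ∘ Subtype.val) (𝓝 x)
    rw [← Filter.map_map, map_nhds_subtype_coe_eq_nhds x.2 (hΩ.mem_nhds x.2),
      gradv_nhds hΩ hf hpos x.2]
  have hemb := Topology.IsOpenEmbedding.of_continuous_injective_isOpenMap hec hei heo
  set K := {q : Fin 2 → ℝ | (q 0 - w 0) ^ 2 + (q 1 - w 1) ^ 2 ≤ r ^ 2} with hK
  have hKc : IsCompact K := by
    apply Metric.isCompact_of_isClosed_isBounded
    · exact isClosed_le (by fun_prop) (by fun_prop)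
    · refine (Metric.isBounded_closedBall (x := w) (r := |r|)).subset ?_
      intro q hq
      have hq' : (q 0 - w 0) ^ 2 + (q 1 - w 1) ^ 2 ≤ r ^ 2 := hq
      rw [Metric.mem_closedBall, dist_pi_le_iff (abs_nonneg r)]
      intro i
      rw [Real.dist_eq]
      apply sq_le_sq.1
      fin_cases i
      · simp; nlinarith [sq_nonneg (q 1 - w 1)]
      · simp; nlinarith [sq_nonneg (q 0 - w 0)]
  have hrange : K ⊆ Set.range e := by
    intro q hq
    obtain ⟨x, hx, rfl⟩ := hsub hq
    exact ⟨⟨x, hx⟩, rfl⟩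
  have h1 := hemb.isInducing.isCompact_preimage' hKc hrange
  have h2 := h1.image continuous_subtype_val
  convert h2 using 1
  ext x
  simp [hK, e, gradv, and_comm]

end topo
section alg

set_option maxHeartbeats 4000000 in
/-- The pointwise algebra at the maximum. -/
lemma max_alg {κ k R r A a b c D η s0 s1 y0 y1 p0 p1 : ℝ}
    (hk : |κ| ≤ k) (hR : 0 ≤ R) (hr : 0 < r)
    (hA : A = 1 / (2 * (k + 1) * (R ^ 2 + 1)))
    (ha : 0 < a) (hc : 0 < c) (hD : 0 < D) (hDe : D = a * c - b * b)
    (hη : 0 < η) (hηr : η ≤ r ^ 2) (hs : s0 ^ 2 + s1 ^ 2 ≤ r ^ 2) (hy : y0 ^ 2 + y1 ^ 2 ≤ R ^ 2)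
    (hp0 : p0 = 4 * (a * s0 + b * s1) / η - A * y0)
    (hp1 : p1 = 4 * (b * s0 + c * s1) / η - A * y1)
    (hmain : κ * (c * p0 ^ 2 - 2 * b * p0 * p1 + a * p1 ^ 2)
      + 2 / η * (-2 * (a + c) * D + 2 * D * (s0 * p0 + s1 * p1))
      - 2 / η ^ 2 * (4 * D * (s0 * (a * s0 + b * s1) + s1 * (b * s0 + c * s1)))
      + A * (a + c) ≤ 0) :
    η ^ 2 / D ≤ 4 * (16 * k + 12) * r ^ 2 / A + 4 * (8 * k + 4) ^ 2 * r ^ 2 * R ^ 2 := by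
  have hk0 : 0 ≤ k := (abs_nonneg κ).trans hk
  have hk1 := abs_le.1 hk
  have hA0 : 0 < A := by rw [hA]; positivity
  have hAk : A * (k * R ^ 2) ≤ 1 / 2 := by
    rw [hA, div_mul_eq_mul_div, div_le_div_iff₀ (by positivity) (by norm_num)]
    linarith [sq_nonneg R, mul_nonneg hk0 (sq_nonneg R)]
  set T := a + c with hT
  set q := s0 * (a * s0 + b * s1) + s1 * (b * s0 + c * s1) with hq
  set m := s0 * y0 + s1 * y1 with hm
  set Y := c * y0 ^ 2 - 2 * b * y0 * y1 + a * y1 ^ 2 with hY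
  clear_value T q m Y
  have hT0 : 0 < T := by rw [hT]; positivity
  have hq0 : 0 ≤ q := by
    have : a * q = (a * s0 + b * s1) ^ 2 + D * s1 ^ 2 := by rw [hq, hDe]; ring
    have h2 : 0 ≤ a * q := by rw [this]; positivity
    exact nonneg_of_mul_nonneg_right h2 ha
  have hY0 : 0 ≤ Y := by
    have : a * Y = (b * y0 - a * y1) ^ 2 + D * y0 ^ 2 := by rw [hY, hDe]; ring
    have h2 : 0 ≤ a * Y := by rw [this]; positivity
    exact nonneg_of_mul_nonneg_right h2 ha
  have hqT : q ≤ r ^ 2 * T := by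
    -- `T |s|² - q = c s0² - 2 b s0 s1 + a s1²`
    have h1 : T * (s0 ^ 2 + s1 ^ 2) - q = c * s0 ^ 2 - 2 * b * s0 * s1 + a * s1 ^ 2 := by
      rw [hq, hT]; ring
    have h2 : 0 ≤ c * s0 ^ 2 - 2 * b * s0 * s1 + a * s1 ^ 2 := by
      have : a * (c * s0 ^ 2 - 2 * b * s0 * s1 + a * s1 ^ 2)
          = (b * s0 - a * s1) ^ 2 + D * s0 ^ 2 := by rw [hDe]; ring
      exact nonneg_of_mul_nonneg_right (a := a) (by rw [this]; positivity) ha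
    have h3 := mul_le_mul_of_nonneg_left hs hT0.le
    linarith
  have hYT : Y ≤ R ^ 2 * T := by
    have h1 : T * (y0 ^ 2 + y1 ^ 2) - Y = a * y0 ^ 2 + 2 * b * y0 * y1 + c * y1 ^ 2 := by
      rw [hY, hT]; ring
    have h2 : 0 ≤ a * y0 ^ 2 + 2 * b * y0 * y1 + c * y1 ^ 2 := by
      have : a * (a * y0 ^ 2 + 2 * b * y0 * y1 + c * y1 ^ 2)
          = (a * y0 + b * y1) ^ 2 + D * y1 ^ 2 := by rw [hDe]; ring
      exact nonneg_of_mul_nonneg_right (a := a) (by rw [this]; positivity) ha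
    have h3 := mul_le_mul_of_nonneg_left hy hT0.le
    linarith
  have hmR : |m| ≤ r * R := by
    apply abs_le_of_sq_le_sq _ (by positivity)
    have h1 : m ^ 2 ≤ (s0 ^ 2 + s1 ^ 2) * (y0 ^ 2 + y1 ^ 2) := by
      rw [hm]; linarith [sq_nonneg (s0 * y1 - s1 * y0)]
    calc m ^ 2 ≤ (s0 ^ 2 + s1 ^ 2) * (y0 ^ 2 + y1 ^ 2) := h1
      _ ≤ r ^ 2 * R ^ 2 := mul_le_mul hs hy (by positivity) (by positivity)
      _ = (r * R) ^ 2 := by ring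
  -- expand
  have hE : κ * (16 * D * q / η ^ 2 - 8 * A * D * m / η + A ^ 2 * Y)
      - 4 * T * D / η + 8 * D * q / η ^ 2 - 4 * A * D * m / η + A * T ≤ 0 := by
    refine le_of_eq_of_le ?_ hmain
    rw [hp0, hp1, hq, hm, hY, hDe]
    field_simp
    ring
  -- multiply by `η² / D`
  have hE2 : A * T * η ^ 2 ≤ D * (-(16 * κ + 8) * q + 4 * T * η + (8 * κ + 4) * A * m * η)
      - κ * A ^ 2 * Y * η ^ 2 := by
    have h := mul_nonpos_of_nonneg_of_nonpos (sq_nonneg η) hE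
    have e : η ^ 2 * (κ * (16 * D * q / η ^ 2 - 8 * A * D * m / η + A ^ 2 * Y)
      - 4 * T * D / η + 8 * D * q / η ^ 2 - 4 * A * D * m / η + A * T) =
      A * T * η ^ 2 - (D * (-(16 * κ + 8) * q + 4 * T * η + (8 * κ + 4) * A * m * η)
      - κ * A ^ 2 * Y * η ^ 2) := by field_simp; ring
    linarith
  have b1 : -(16 * κ + 8) * q ≤ (16 * k + 8) * (r ^ 2 * T) :=
    calc -(16 * κ + 8) * q ≤ (16 * k + 8) * q := by gcongr; linarith
      _ ≤ _ := by gcongr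
  have b2 : 4 * T * η ≤ 4 * (r ^ 2 * T) := by linarith [mul_le_mul_of_nonneg_left hηr hT0.le]
  have b3 : (8 * κ + 4) * A * m * η ≤ (8 * k + 4) * A * (r * R) * η := by
    gcongr ?_ * η
    calc (8 * κ + 4) * A * m ≤ |(8 * κ + 4) * A * m| := le_abs_self _
      _ = |8 * κ + 4| * A * |m| := by rw [abs_mul, abs_mul, abs_of_pos hA0]
      _ ≤ (8 * k + 4) * A * (r * R) := by
        gcongr
        rw [abs_le]; constructor <;> linarith
  have b4 : -(κ * A ^ 2 * Y * η ^ 2) ≤ A / 2 * T * η ^ 2 := by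
    have h1 : -(κ * Y) ≤ k * (R ^ 2 * T) :=
      calc -(κ * Y) = (-κ) * Y := by ring
        _ ≤ k * Y := by gcongr; linarith
        _ ≤ _ := by gcongr
    calc -(κ * A ^ 2 * Y * η ^ 2) = A ^ 2 * η ^ 2 * -(κ * Y) := by ring
      _ ≤ A ^ 2 * η ^ 2 * (k * (R ^ 2 * T)) := by gcongr
      _ = (A * (k * R ^ 2)) * (A * T * η ^ 2) := by ring
      _ ≤ 1 / 2 * (A * T * η ^ 2) := by gcongr
      _ = _ := by ring
  have hE3 : A / 2 * T * η ^ 2 ≤ D * ((16 * k + 12) * (r ^ 2 * T)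
      + (8 * k + 4) * A * (r * R) * η) := by
    have : D * (-(16 * κ + 8) * q + 4 * T * η + (8 * κ + 4) * A * m * η) ≤
        D * ((16 * k + 12) * (r ^ 2 * T) + (8 * k + 4) * A * (r * R) * η) := by
      gcongr; linarith
    linarith
  rcases le_total ((8 * k + 4) * A * (r * R) * η * D) (A / 4 * T * η ^ 2) with hcase | hcase
  · have h1 : A / 4 * T * η ^ 2 ≤ D * ((16 * k + 12) * (r ^ 2 * T)) := by linarith
    have h2 : η ^ 2 / D ≤ 4 * (16 * k + 12) * r ^ 2 / A := by
      rw [div_le_div_iff₀ hD hA0]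
      have : T * (η ^ 2 * A) ≤ T * (4 * (16 * k + 12) * r ^ 2 * D) := by linarith
      exact le_of_mul_le_mul_left this hT0
    have h3 : 0 ≤ 4 * (8 * k + 4) ^ 2 * r ^ 2 * R ^ 2 := by positivity
    linarith
  · have h1 : T * η ≤ 4 * (8 * k + 4) * (r * R) * D := by
      have : A * η * (T * η) ≤ A * η * (4 * (8 * k + 4) * (r * R) * D) := by linarith
      exact le_of_mul_le_mul_left this (by positivity)
    have hT2 : 4 * D ≤ T ^ 2 := by
      rw [hT, hDe]; linarith [sq_nonneg (a - c), sq_nonneg b]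
    have h2 : η ^ 2 / D ≤ 4 * (8 * k + 4) ^ 2 * r ^ 2 * R ^ 2 := by
      rw [div_le_iff₀ hD]
      have h4 : (T * η) ^ 2 ≤ (4 * (8 * k + 4) * (r * R) * D) ^ 2 := by gcongr
      have h5 : 4 * D * η ^ 2 ≤ T ^ 2 * η ^ 2 := by gcongr
      have h6 : 4 * D * η ^ 2 ≤ 4 * D * (4 * (8 * k + 4) ^ 2 * r ^ 2 * R ^ 2 * D) := by
        linarith
      exact le_of_mul_le_mul_left h6 (by positivity)
    have h3 : 0 ≤ 4 * (16 * k + 12) * r ^ 2 / A := by positivity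
    linarith

end alg
section maxpt

variable {Ω : Set (Fin 2 → ℝ)} {f : (Fin 2 → ℝ) → ℝ}

/-- The cutoff function `η = r² - |∇f - w|²`. -/
noncomputable def eta (f : (Fin 2 → ℝ) → ℝ) (w : Fin 2 → ℝ) (r : ℝ) : (Fin 2 → ℝ) → ℝ :=
  fun y => r ^ 2 - ((pd 0 f y - w 0) ^ 2 + (pd 1 f y - w 1) ^ 2)

/-- The auxiliary function `log (1/det) + 2 log η + (A/2) |y - x₀|²`. -/
noncomputable def zfun (f : (Fin 2 → ℝ) → ℝ) (w x₀ : Fin 2 → ℝ) (r A : ℝ) : (Fin 2 → ℝ) → ℝ :=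
  fun y => phi f y + (2 * Real.log (eta f w r y)
    + A / 2 * ((y 0 - x₀ 0) ^ 2 + (y 1 - x₀ 1) ^ 2))

lemma cd_eta (hΩ : IsOpen Ω) (hf : ContDiffOn ℝ (⊤ : ℕ∞) f Ω) (w : Fin 2 → ℝ) (r : ℝ) :
    ContDiffOn ℝ (⊤ : ℕ∞) (eta f w r) Ω :=
  contDiffOn_const.sub ((((cd_pd hΩ hf 0).sub contDiffOn_const).pow 2).add
    (((cd_pd hΩ hf 1).sub contDiffOn_const).pow 2))

lemma pd_sub_const {g : (Fin 2 → ℝ) → ℝ} {x : Fin 2 → ℝ} (hg : DifferentiableAt ℝ g x)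
    (k : ℝ) (i : Fin 2) : pd i (fun y => g y - k) x = pd i g x := by
  rw [pd_sub hg (differentiableAt_const k), pd_const, sub_zero]

lemma pd_eta (hΩ : IsOpen Ω) (hf : ContDiffOn ℝ (⊤ : ℕ∞) f Ω) (w : Fin 2 → ℝ) (r : ℝ)
    {x : Fin 2 → ℝ} (hx : x ∈ Ω) (j : Fin 2) :
    pd j (eta f w r) x = -2 * ((pd 0 f x - w 0) * pd j (pd 0 f) x
      + (pd 1 f x - w 1) * pd j (pd 1 f) x) := by
  have h : ∀ k, DifferentiableAt ℝ (pd k f) x := fun k => cd_diff hΩ (cd_pd hΩ hf k) hx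
  have hk : ∀ k, DifferentiableAt ℝ (fun y => pd k f y - w k) x := fun k => (h k).sub_const _
  have e : eta f w r = fun y => r ^ 2 - ((pd 0 f y - w 0) * (pd 0 f y - w 0)
      + (pd 1 f y - w 1) * (pd 1 f y - w 1)) := by
    funext y; simp only [eta]; ring
  rw [e, pd_sub (differentiableAt_const _) (((hk 0).fun_mul (hk 0)).fun_add
    ((hk 1).fun_mul (hk 1))), pd_const,
    pd_add ((hk 0).fun_mul (hk 0)) ((hk 1).fun_mul (hk 1)), pd_mul (hk 0) (hk 0),
    pd_mul (hk 1) (hk 1), pd_sub_const (h 0), pd_sub_const (h 1)]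
  ring

lemma pd_pd_eta (hΩ : IsOpen Ω) (hf : ContDiffOn ℝ (⊤ : ℕ∞) f Ω) (w : Fin 2 → ℝ) (r : ℝ)
    {x : Fin 2 → ℝ} (hx : x ∈ Ω) (i j : Fin 2) :
    pd i (pd j (eta f w r)) x = -2 * ((pd 0 f x - w 0) * pd i (pd j (pd 0 f)) x
      + pd i (pd 0 f) x * pd j (pd 0 f) x
      + ((pd 1 f x - w 1) * pd i (pd j (pd 1 f)) x + pd i (pd 1 f) x * pd j (pd 1 f) x)) := by
  have h : ∀ k, DifferentiableAt ℝ (pd k f) x := fun k => cd_diff hΩ (cd_pd hΩ hf k) hx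
  have hk : ∀ k, DifferentiableAt ℝ (fun y => pd k f y - w k) x := fun k => (h k).sub_const _
  have h2 : ∀ k, DifferentiableAt ℝ (pd j (pd k f)) x :=
    fun k => cd_diff hΩ (cd_pd hΩ (cd_pd hΩ hf k) j) hx
  rw [pd_congr hΩ (fun y hy => pd_eta hΩ hf w r hy j) i hx,
    pd_const_mul (((hk 0).fun_mul (h2 0)).fun_add ((hk 1).fun_mul (h2 1))),
    pd_add ((hk 0).fun_mul (h2 0)) ((hk 1).fun_mul (h2 1)), pd_mul (hk 0) (h2 0),
    pd_mul (hk 1) (h2 1), pd_sub_const (h 0), pd_sub_const (h 1)]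

lemma pd_quad (x₀ x : Fin 2 → ℝ) (A : ℝ) (j : Fin 2) :
    pd j (fun y => A / 2 * ((y 0 - x₀ 0) ^ 2 + (y 1 - x₀ 1) ^ 2)) x = A * (x j - x₀ j) := by
  have h : ∀ k, DifferentiableAt ℝ (fun y : Fin 2 → ℝ => y k) x := fun k => by fun_prop
  have hk : ∀ k, DifferentiableAt ℝ (fun y : Fin 2 → ℝ => y k - x₀ k) x :=
    fun k => (h k).sub_const _
  simp only [pow_two]
  rw [pd_const_mul (((hk 0).fun_mul (hk 0)).fun_add ((hk 1).fun_mul (hk 1))),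
    pd_add ((hk 0).fun_mul (hk 0)) ((hk 1).fun_mul (hk 1)), pd_mul (hk 0) (hk 0),
    pd_mul (hk 1) (hk 1), pd_sub_const (h 0), pd_sub_const (h 1), pd_coord, pd_coord]
  fin_cases j <;> simp <;> ring

lemma cd_zfun (hΩ : IsOpen Ω) (hf : ContDiffOn ℝ (⊤ : ℕ∞) f Ω)
    (hpos : ∀ x ∈ Ω, (hess f x).PosDef) {U : Set (Fin 2 → ℝ)} (hUΩ : U ⊆ Ω)
    (w x₀ : Fin 2 → ℝ) (r A : ℝ) (hη : ∀ y ∈ U, 0 < eta f w r y) :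
    ContDiffOn ℝ (⊤ : ℕ∞) (zfun f w x₀ r A) U := by
  refine ((cd_phi hΩ hf hpos).mono hUΩ).add ((contDiffOn_const.mul
    (((cd_eta hΩ hf w r).mono hUΩ).log fun y hy => (hη y hy).ne')).add ?_)
  apply ContDiff.contDiffOn
  fun_prop

lemma pd_zfun (hΩ : IsOpen Ω) (hf : ContDiffOn ℝ (⊤ : ℕ∞) f Ω)
    (hpos : ∀ x ∈ Ω, (hess f x).PosDef) (w x₀ : Fin 2 → ℝ) (r A : ℝ)
    {x : Fin 2 → ℝ} (hx : x ∈ Ω) (hη : 0 < eta f w r x) (j : Fin 2) :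
    pd j (zfun f w x₀ r A) x = pd j (phi f) x + (2 * ((eta f w r x)⁻¹ * pd j (eta f w r) x)
      + A * (x j - x₀ j)) := by
  have hφ := cd_diff hΩ (cd_phi hΩ hf hpos) hx
  have hηd := cd_diff hΩ (cd_eta hΩ hf w r) hx
  have hl : DifferentiableAt ℝ (fun y => Real.log (eta f w r y)) x := hηd.log hη.ne'
  have hq : DifferentiableAt ℝ
      (fun y : Fin 2 → ℝ => A / 2 * ((y 0 - x₀ 0) ^ 2 + (y 1 - x₀ 1) ^ 2)) x := by fun_prop
  unfold zfun
  rw [pd_add hφ ((hl.const_mul 2).fun_add hq), pd_add (hl.const_mul 2) hq, pd_quad,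
    pd_const_mul hl, pd_comp hηd (Real.hasDerivAt_log hη.ne')]

lemma pd_pd_zfun (hΩ : IsOpen Ω) (hf : ContDiffOn ℝ (⊤ : ℕ∞) f Ω)
    (hpos : ∀ x ∈ Ω, (hess f x).PosDef) {U : Set (Fin 2 → ℝ)} (hU : IsOpen U) (hUΩ : U ⊆ Ω)
    (w x₀ : Fin 2 → ℝ) (r A : ℝ) (hη : ∀ y ∈ U, 0 < eta f w r y)
    {x : Fin 2 → ℝ} (hx : x ∈ U) (i j : Fin 2) :
    pd i (pd j (zfun f w x₀ r A)) x = pd i (pd j (phi f)) x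
      + (2 * ((eta f w r x)⁻¹ * pd i (pd j (eta f w r)) x
        - ((eta f w r x) ^ 2)⁻¹ * pd i (eta f w r) x * pd j (eta f w r) x)
      + A * if i = j then 1 else 0) := by
  have hx' := hUΩ hx
  have hφ := cd_diff hΩ (cd_pd hΩ (cd_phi hΩ hf hpos) j) hx'
  have hηd := cd_diff hΩ (cd_eta hΩ hf w r) hx'
  have hηj := cd_diff hΩ (cd_pd hΩ (cd_eta hΩ hf w r) j) hx'
  have hη0 := (hη x hx).ne'
  have hi : DifferentiableAt ℝ (fun y => (eta f w r y)⁻¹) x := hηd.fun_inv hη0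
  have hm := hi.fun_mul hηj
  have hc : DifferentiableAt ℝ (fun y : Fin 2 → ℝ => y j) x := by fun_prop
  have hcc : DifferentiableAt ℝ (fun y : Fin 2 → ℝ => y j - x₀ j) x := hc.sub_const _
  rw [pd_congr hU (fun y hy => pd_zfun hΩ hf hpos w x₀ r A (hUΩ hy) (hη y hy) j) i hx,
    pd_add hφ ((hm.const_mul 2).fun_add (hcc.const_mul A)),
    pd_add (hm.const_mul 2) (hcc.const_mul A), pd_const_mul hm, pd_const_mul hcc,
    pd_sub_const hc, pd_coord, pd_mul hi hηj,
    pd_comp (k := fun t => t⁻¹) hηd (hasDerivAt_inv hη0)]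
  ring

set_option maxHeartbeats 4000000 in
lemma at_max (hΩ : IsOpen Ω) (hf : ContDiffOn ℝ (⊤ : ℕ∞) f Ω)
    (hpos : ∀ x ∈ Ω, (hess f x).PosDef) {β : ℝ} (hP : PDE2 f β Ω)
    (w x₀ : Fin 2 → ℝ) {r A R k : ℝ} (hk : |(-(3 + β) / 4)| ≤ k) (hR : 0 ≤ R) (hr : 0 < r)
    (hA : A = 1 / (2 * (k + 1) * (R ^ 2 + 1)))
    {x : Fin 2 → ℝ} (hx : x ∈ Ω) (hη : 0 < eta f w r x)
    (hxR : (x 0 - x₀ 0) ^ 2 + (x 1 - x₀ 1) ^ 2 ≤ R ^ 2)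
    (hmax : IsLocalMax (zfun f w x₀ r A) x) :
    eta f w r x ^ 2 / (hess f x).det ≤
      4 * (16 * k + 12) * r ^ 2 / A + 4 * (8 * k + 4) ^ 2 * r ^ 2 * R ^ 2 := by
  set U := Ω ∩ (eta f w r) ⁻¹' (Set.Ioi 0) with hUdef
  have hU : IsOpen U := (cd_eta hΩ hf w r).continuousOn.isOpen_inter_preimage hΩ isOpen_Ioi
  have hUΩ : U ⊆ Ω := Set.inter_subset_left
  have hUη : ∀ y ∈ U, 0 < eta f w r y := fun y hy => hy.2
  have hxU : x ∈ U := ⟨hx, hη⟩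
  have hz := cd_zfun hΩ hf hpos hUΩ w x₀ r A hUη
  have hp := (hpos x hx).det_pos
  have ha : 0 < pd 0 (pd 0 f) x := (hpos x hx).diag_pos (i := 0)
  have hc : 0 < pd 1 (pd 1 f) x := (hpos x hx).diag_pos (i := 1)
  have hD := det_eq hΩ hf hx
  have h10 : pd 1 (pd 0 f) x = pd 0 (pd 1 f) x := pd_comm hΩ hf hx 1 0
  have f0 := first_test hmax 0
  have f1 := first_test hmax 1
  rw [pd_zfun hΩ hf hpos w x₀ r A hx hη, pd_eta hΩ hf w r hx] at f0 f1
  have s1 := second_test hU hz hxU hmax ![1, 0]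
  have s2 := second_test hU hz hxU hmax ![pd 0 (pd 1 f) x, -pd 0 (pd 0 f) x]
  have sym := pd_comm hU hz hxU 1 0
  simp only [Matrix.cons_val_zero, Matrix.cons_val_one, sym] at s1 s2
  have hkey : pd 1 (pd 1 f) x * pd 0 (pd 0 (zfun f w x₀ r A)) x
      - 2 * pd 0 (pd 1 f) x * pd 0 (pd 1 (zfun f w x₀ r A)) x
      + pd 0 (pd 0 f) x * pd 1 (pd 1 (zfun f w x₀ r A)) x ≤ 0 := by
    have h1 : (hess f x).det * pd 0 (pd 0 (zfun f w x₀ r A)) x ≤ 0 :=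
      mul_nonpos_of_nonneg_of_nonpos hp.le (by linarith)
    rw [hD] at h1
    have h2 : pd 0 (pd 0 f) x * (pd 1 (pd 1 f) x * pd 0 (pd 0 (zfun f w x₀ r A)) x
      - 2 * pd 0 (pd 1 f) x * pd 0 (pd 1 (zfun f w x₀ r A)) x
      + pd 0 (pd 0 f) x * pd 1 (pd 1 (zfun f w x₀ r A)) x) ≤ 0 := by linarith
    exact nonpos_of_mul_nonpos_right h2 ha
  have hpde := pde_expand hΩ hf hpos hP hx
  have g0 := pd_phi hΩ hf hpos hx 0
  have g1 := pd_phi hΩ hf hpos hx 1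
  have t1 : pd 0 (pd 1 (pd 1 f)) x = pd 1 (pd 0 (pd 1 f)) x :=
    pd_comm hΩ (cd_pd hΩ hf 1) hx 0 1
  have t2 : pd 0 (pd 0 (pd 1 f)) x = pd 1 (pd 0 (pd 0 f)) x := by
    rw [pd_congr hΩ (fun y hy => pd_comm hΩ hf hy 0 1) 0 hx]
    exact pd_comm hΩ (cd_pd hΩ hf 0) hx 0 1
  have t3 : pd 0 (pd 1 (pd 0 f)) x = pd 1 (pd 0 (pd 0 f)) x :=
    pd_comm hΩ (cd_pd hΩ hf 0) hx 0 1
  have t4 : pd 1 (pd 1 (pd 0 f)) x = pd 1 (pd 0 (pd 1 f)) x :=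
    pd_congr hΩ (fun y hy => pd_comm hΩ hf hy 1 0) 1 hx
  rw [pd_pd_zfun hΩ hf hpos hU hUΩ w x₀ r A hUη hxU, pd_pd_zfun hΩ hf hpos hU hUΩ w x₀ r A hUη hxU,
    pd_pd_zfun hΩ hf hpos hU hUΩ w x₀ r A hUη hxU] at hkey
  simp only [pd_pd_eta hΩ hf w r hx, pd_eta hΩ hf w r hx, h10, t1, t2, t3, t4] at hkey f0 f1 g0 g1
  have hηr : eta f w r x ≤ r ^ 2 := by
    unfold eta; linarith [sq_nonneg (pd 0 f x - w 0), sq_nonneg (pd 1 f x - w 1)]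
  have hs : (pd 0 f x - w 0) ^ 2 + (pd 1 f x - w 1) ^ 2 ≤ r ^ 2 := by
    have : 0 < r ^ 2 - ((pd 0 f x - w 0) ^ 2 + (pd 1 f x - w 1) ^ 2) := hη
    linarith
  refine max_alg (κ := -(3 + β) / 4) (a := pd 0 (pd 0 f) x) (b := pd 0 (pd 1 f) x)
    (c := pd 1 (pd 1 f) x) (s0 := pd 0 f x - w 0) (s1 := pd 1 f x - w 1)
    (y0 := x 0 - x₀ 0) (y1 := x 1 - x₀ 1) (p0 := pd 0 (phi f) x) (p1 := pd 1 (phi f) x)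
    hk hR hr hA ha hc hp hD hη hηr hs hxR ?_ ?_ ?_
  · rw [div_eq_inv_mul]; linarith
  · rw [div_eq_inv_mul]; linarith
  · rw [← hpde]
    refine le_of_eq_of_le ?_ hkey
    simp only [Fin.isValue, reduceIte, zero_ne_one]
    generalize eta f w r x = e at *
    generalize pd 0 f x - w 0 = σ0 at *
    generalize pd 1 f x - w 1 = σ1 at *
    rw [hD] at g0 g1 ⊢
    simp only [div_eq_mul_inv]
    linear_combination (4 * e⁻¹ * σ0) * g0 + (4 * e⁻¹ * σ1) * g1

end maxpt
/-- Lemma 3.3: lower determinant estimate. For a smooth strictly convex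
solution `f` of PDE (1.2) on a bounded convex domain `Ω ⊂ ℝ²` with diam`(Ω) ≤ D₁`,
Legendre transform domain `Ω* = ∇f(Ω)` with diam`(Ω*) ≤ D₂`, and any subdomain
`Ω'* ⊆ Ω*` with `dist(Ω'*, ∂Ω*) ≥ δ > 0`, one has `det(f_ij) ≥ b₀` whenever
`∇f(x) ∈ Ω'*`, where `b₀` depends only on `δ`, `D₁`, `D₂` and `β`. -/
theorem statement9 (β δ D₁ D₂ : ℝ) (hδ : 0 < δ) :
    ∃ b₀ : ℝ, 0 < b₀ ∧
      ∀ (Ω : Set (Fin 2 → ℝ)) (f : (Fin 2 → ℝ) → ℝ),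
        IsOpen Ω → Convex ℝ Ω → Bornology.IsBounded Ω →
        ContDiffOn ℝ (⊤ : ℕ∞) f Ω → (∀ x ∈ Ω, (hess f x).PosDef) → PDE2 f β Ω →
        (∀ p ∈ Ω, ∀ q ∈ Ω, enorm2 (p - q) ≤ D₁) →
        (∀ p ∈ gradv f '' Ω, ∀ q ∈ gradv f '' Ω, enorm2 (p - q) ≤ D₂) →
        ∀ Ω' : Set (Fin 2 → ℝ), Ω' ⊆ gradv f '' Ω →
        (∀ p ∈ Ω', ∀ q ∈ frontier (gradv f '' Ω), δ ≤ enorm2 (p - q)) →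
        ∀ x ∈ Ω, gradv f x ∈ Ω' → b₀ ≤ (hess f x).det := by
  set k := |(-(3 + β) / 4)| with hkdef
  set R := |D₁| with hRdef
  set r := δ / 2 with hrdef
  set A := 1 / (2 * (k + 1) * (R ^ 2 + 1)) with hA
  set M := 4 * (16 * k + 12) * r ^ 2 / A + 4 * (8 * k + 4) ^ 2 * r ^ 2 * R ^ 2 with hM
  have hk0 : 0 ≤ k := abs_nonneg _
  have hR0 : 0 ≤ R := abs_nonneg _
  have hr0 : 0 < r := by positivity
  have hA0 : 0 < A := by positivity
  have hM0 : 0 < M := by positivity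
  refine ⟨(r ^ 2) ^ 2 / (M * Real.exp (A / 2 * R ^ 2)), by positivity, ?_⟩
  intro Ω f hΩ hcv _ hf hpos hP hD1 _ Ω' hΩ' hdist x₀ hx₀ hx₀'
  set w := gradv f x₀ with hw
  have hsub := gball_sub (Set.mem_image_of_mem (gradv f) hx₀) hr0.le
    (by rw [hrdef]; linarith : r < δ) (fun q hq => hdist w hx₀' q hq)
  have hK := compact_pre hΩ hcv hf hpos hsub
  set K := {x | x ∈ Ω ∧ (pd 0 f x - gradv f x₀ 0) ^ 2 + (pd 1 f x - gradv f x₀ 1) ^ 2 ≤ r ^ 2}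
    with hKdef
  have hw0 : pd 0 f x₀ - w 0 = 0 := sub_self _
  have hw1 : pd 1 f x₀ - w 1 = 0 := sub_self _
  have hx₀K : x₀ ∈ K := by
    refine ⟨hx₀, ?_⟩
    rw [← hw, hw0, hw1]; simp; positivity
  have hη₀ : eta f w r x₀ = r ^ 2 := by
    unfold eta; rw [hw0, hw1]; ring
  have hdist2 : ∀ x ∈ Ω, (x 0 - x₀ 0) ^ 2 + (x 1 - x₀ 1) ^ 2 ≤ R ^ 2 := by
    intro x hx
    exact (enorm2_le hR0).1 ((hD1 x hx x₀ hx₀).trans (le_abs_self D₁))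
  let g : (Fin 2 → ℝ) → ℝ := fun y => eta f w r y ^ 2 / (hess f y).det *
    Real.exp (A / 2 * ((y 0 - x₀ 0) ^ 2 + (y 1 - x₀ 1) ^ 2))
  have hgc : ContinuousOn g Ω := by
    refine ContinuousOn.mul (((cd_eta hΩ hf w r).continuousOn.pow 2).div
      (cd_det hΩ hf).continuousOn fun y hy => (hpos y hy).det_pos.ne') ?_
    exact Continuous.continuousOn (by fun_prop)
  have hKΩ : K ⊆ Ω := fun y hy => hy.1
  obtain ⟨x, hxK, hxmax⟩ := hK.exists_isMaxOn ⟨x₀, hx₀K⟩ (hgc.mono hKΩ)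
  have hx := hKΩ hxK
  have hdx := (hpos x hx).det_pos
  have hd₀ := (hpos x₀ hx₀).det_pos
  have hg₀ : g x₀ = (r ^ 2) ^ 2 / (hess f x₀).det := by
    simp only [g, hη₀]; simp
  have hle : g x₀ ≤ g x := hxmax hx₀K
  have hgx : 0 < g x := lt_of_lt_of_le (by rw [hg₀]; positivity) hle
  have hηx : 0 < eta f w r x := by
    have h1 : 0 ≤ eta f w r x := sub_nonneg.2 hxK.2
    rcases h1.lt_or_eq with h | h
    · exact h
    · simp only [g, ← h] at hgx
      simp at hgx
  have hlog : ∀ y ∈ Ω, 0 < eta f w r y → zfun f w x₀ r A y = Real.log (g y) := by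
    intro y hy hη
    have hd := (hpos y hy).det_pos
    simp only [g]
    rw [Real.log_mul (by positivity) (Real.exp_pos _).ne', Real.log_div (by positivity) hd.ne',
      Real.log_exp, Real.log_pow]
    unfold zfun phi
    push_cast; ring
  have hlm : IsLocalMax (zfun f w x₀ r A) x := by
    have hU : IsOpen (Ω ∩ (eta f w r) ⁻¹' (Set.Ioi 0)) :=
      (cd_eta hΩ hf w r).continuousOn.isOpen_inter_preimage hΩ isOpen_Ioi
    filter_upwards [hU.mem_nhds ⟨hx, hηx⟩] with y hy
    have hyη : 0 < eta f w r y := hy.2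
    rw [hlog y hy.1 hyη, hlog x hx hηx]
    have hd := (hpos y hy.1).det_pos
    apply Real.log_le_log
    · simp only [g]; positivity
    · exact hxmax ⟨hy.1, (sub_pos.1 hyη).le⟩
  have hbound := at_max hΩ hf hpos hP w x₀ (le_refl k) hR0 hr0 hA hx hηx (hdist2 x hx) hlm
  have hgM : g x ≤ M * Real.exp (A / 2 * R ^ 2) := by
    simp only [g]
    have := hdist2 x hx
    gcongr
  rw [hg₀] at hle
  have h := hle.trans hgM
  rw [div_le_iff₀ hd₀] at h
  rw [div_le_iff₀ (by positivity)]
  linarith
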